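/- arXiv:1702.05022 — 7 statements merged into one kernel-verified Lean document; each statement's English description precedes it below -/
import Mathlib

section
/- Let d ≥ 1 be an integer and let g : ℝ^d → ℝ be a nonnegative function with ∫ g(x)² dx = 1, such that g is (weakly) differentiable with ∫ ‖∇g(x)‖² dx < ∞. Then the entropy of the probability density f = g² with respect to Lebesgue measure satisfies the logarithmic Sobolev inequality ∫ g(x)² log(g(x)²) dx ≤ (1/π) ∫ ‖∇g(x)‖² dx. -/
open MeasureTheory Filter Topology
open scoped ENNReal

theorem LW_aux {ι : Type*} [Fintype ι] [DecidableEq ι] (F : ι → (ι → ℝ) → ℝ≥0∞)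
    (hF : ∀ i, Measurable (F i)) (p : ℝ) (hp : 0 ≤ p) (hcard : ((Fintype.card ι : ℝ) - 1) * p = 1)
    (s : Finset ι) (x : ι → ℝ) :
    lmarginal (fun _ => (volume : Measure ℝ)) s
      (fun x => ∏ i, (lmarginal (fun _ => (volume : Measure ℝ)) {i} (F i) x) ^ p) x ≤
    ∏ i, (lmarginal (fun _ => (volume : Measure ℝ)) (insert i s) (F i) x) ^ p := by
  have hm : ∀ s i, Measurable (lmarginal (fun _ => (volume : Measure ℝ)) s (F i)) :=
    fun s i => (hF i).lmarginal _
  induction s using Finset.induction generalizing x with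
  | empty => simp
  | insert j s hj ih =>
    rw [lmarginal_insert _ (Finset.measurable_prod _ fun i _ => (hm _ _).pow_const _) hj]
    calc _ ≤ ∫⁻ t, ∏ i, (lmarginal (fun _ => (volume : Measure ℝ)) (insert i s) (F i)
              (Function.update x j t)) ^ p := lintegral_mono fun t => ih _
      _ = ∫⁻ t, (lmarginal (fun _ => (volume : Measure ℝ)) (insert j s) (F j) x) ^ p *
            ∏ i ∈ Finset.univ.erase j, (lmarginal (fun _ => (volume : Measure ℝ)) (insert i s) (F i)
              (Function.update x j t)) ^ p := by
          congr with t
          rw [← Finset.mul_prod_erase _ _ (Finset.mem_univ j),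
            lmarginal_update_of_mem _ (Finset.mem_insert_self _ _)]
      _ = (lmarginal (fun _ => (volume : Measure ℝ)) (insert j s) (F j) x) ^ p *
            ∫⁻ t, ∏ i ∈ Finset.univ.erase j,
              (lmarginal (fun _ => (volume : Measure ℝ)) (insert i s) (F i)
              (Function.update x j t)) ^ p := by
          rw [lintegral_const_mul]
          exact Finset.measurable_prod _ fun i _ =>
            ((hm _ _).comp (measurable_update x)).pow_const _
      _ ≤ (lmarginal (fun _ => (volume : Measure ℝ)) (insert j s) (F j) x) ^ p *
            ∏ i ∈ Finset.univ.erase j, (∫⁻ t,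
              lmarginal (fun _ => (volume : Measure ℝ)) (insert i s) (F i)
              (Function.update x j t)) ^ p := by
          gcongr
          apply ENNReal.lintegral_prod_norm_pow_le
          · exact fun i _ => ((hm _ _).comp (measurable_update x)).aemeasurable
          · have : 1 ≤ Fintype.card ι := Fintype.card_pos_iff.2 ⟨j⟩
            simp [Finset.card_erase_of_mem, Nat.cast_sub this, hcard]
          · exact fun _ _ => hp
      _ = _ := by
          rw [← Finset.mul_prod_erase _ _ (Finset.mem_univ j)]
          congr 1
          · simp
          · refine Finset.prod_congr rfl fun i hi => ?_
            have hij : i ≠ j := by simpa using hi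
            rw [Finset.insert_comm i j s, lmarginal_insert _ (hF i)]
            simp [hj, hij.symm]

theorem line_bound (φ φ' : ℝ → ℝ) (h : ∀ s, HasDerivAt φ (φ' s) s) (s : ℝ) :
    ENNReal.ofReal (φ s ^ 2) ≤ ∫⁻ r, ENNReal.ofReal ((1 / Real.pi) * φ' r ^ 2 + φ r ^ 2) := by
  have hpi := Real.pi_pos
  by_cases hfin : ∫⁻ r, ENNReal.ofReal ((1 / Real.pi) * φ' r ^ 2 + φ r ^ 2) = ∞
  · rw [hfin]; exact le_top
  have hcont : Continuous φ := continuous_iff_continuousAt.2 fun x => (h x).continuousAt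
  have hφ' : Measurable φ' := by
    have : φ' = deriv φ := funext fun x => (h x).deriv.symm
    rw [this]; exact measurable_deriv φ
  have hI : Integrable (fun r => (1 / Real.pi) * φ' r ^ 2 + φ r ^ 2) := by
    refine (lintegral_ofReal_ne_top_iff_integrable ?_ ?_).1 hfin
    · exact (((hφ'.pow_const 2).const_mul _).add (hcont.measurable.pow_const 2)).aestronglyMeasurable
    · exact Eventually.of_forall fun r => by positivity
  have h1 : Integrable (fun r => φ r ^ 2) := by
    refine hI.mono' (hcont.measurable.pow_const 2).aestronglyMeasurable ?_
    refine Eventually.of_forall fun r => ?_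
    rw [Real.norm_of_nonneg (by positivity)]
    have : 0 ≤ (1 / Real.pi) * φ' r ^ 2 := by positivity
    linarith
  have key : ∀ r, |2 * φ r * φ' r| ≤ 2 * ((1 / Real.pi) * φ' r ^ 2 + φ r ^ 2) := by
    intro r
    have e : (1 / Real.pi) * φ' r ^ 2 + φ r ^ 2 =
      (1 / Real.pi) * (φ' r ^ 2 + Real.pi * φ r ^ 2) := by field_simp
    rw [e, show |2 * φ r * φ' r| = 2 * ((1 / Real.pi) * (Real.pi * (|φ r| * |φ' r|))) by
      rw [abs_mul, abs_mul, abs_two]; field_simp]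
    gcongr
    rw [← sq_abs (φ r), ← sq_abs (φ' r)]
    have := Real.pi_lt_four
    have h2 : Real.pi ^ 2 * |φ r| ^ 2 ≤ 4 * Real.pi * |φ r| ^ 2 := by
      gcongr; nlinarith
    nlinarith [sq_nonneg (|φ' r| - Real.pi / 2 * |φ r|)]
  have h2 : Integrable (fun r => 2 * φ r * φ' r) := by
    refine (hI.const_mul 2).mono' ((hcont.measurable.const_mul 2).mul hφ').aestronglyMeasurable ?_
    exact Eventually.of_forall key
  have hd : ∀ r, HasDerivAt (fun r => φ r ^ 2) (2 * φ r * φ' r) r := fun r => by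
    simpa using (h r).fun_pow 2
  have t1 := tendsto_zero_of_hasDerivAt_of_integrableOn_Ioi (a := s) (fun r _ => hd r)
    h2.integrableOn h1.integrableOn
  have t2 := tendsto_zero_of_hasDerivAt_of_integrableOn_Iic (a := s) (fun r _ => hd r)
    h2.integrableOn h1.integrableOn
  have e1 := integral_Ioi_of_hasDerivAt_of_tendsto' (a := s) (fun r _ => hd r) h2.integrableOn t1
  have e2 := integral_Iic_of_hasDerivAt_of_tendsto' (a := s) (fun r _ => hd r) h2.integrableOn t2
  have b1 : φ s ^ 2 ≤ ∫ r in Set.Ioi s, |2 * φ r * φ' r| := by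
    have := norm_integral_le_integral_norm (μ := volume.restrict (Set.Ioi s))
      (fun r => 2 * φ r * φ' r)
    rw [e1] at this
    simp only [Real.norm_eq_abs, zero_sub, abs_neg] at this
    exact (le_abs_self _).trans this
  have b2 : φ s ^ 2 ≤ ∫ r in Set.Iic s, |2 * φ r * φ' r| := by
    have := norm_integral_le_integral_norm (μ := volume.restrict (Set.Iic s))
      (fun r => 2 * φ r * φ' r)
    rw [e2] at this
    simp only [Real.norm_eq_abs, sub_zero] at this
    exact (le_abs_self _).trans this
  have b3 := intervalIntegral.integral_Iic_add_Ioi (b := s) h2.abs.integrableOn h2.abs.integrableOn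
  have b4 := integral_mono h2.abs (hI.const_mul 2) key
  rw [integral_const_mul] at b4
  rw [← ofReal_integral_eq_lintegral_ofReal hI (Eventually.of_forall fun r => by positivity)]
  apply ENNReal.ofReal_le_ofReal
  linarith

theorem core_bound (d : ℕ) (hd : 1 ≤ d) (G : (Fin d → ℝ) → ℝ) (D : Fin d → (Fin d → ℝ) → ℝ)
    (hG : Continuous G) (hDm : ∀ i, Measurable (D i))
    (hD : ∀ x i s, HasDerivAt (fun s => G (Function.update x i s)) (D i (Function.update x i s)) s)
    (hDint : ∀ i, Integrable (fun x => D i x ^ 2)) (hnorm : ∫ x, G x ^ 2 = 1) :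
    ∫ x, G x ^ 2 * Real.log (G x ^ 2) ≤ (1 / Real.pi) * ∑ i, ∫ x, D i x ^ 2 := by
  have hpi := Real.pi_pos
  have ht : ∀ i, 0 ≤ ∫ x, D i x ^ 2 := fun i => integral_nonneg fun x => sq_nonneg _
  by_cases hent : Integrable (fun x => G x ^ 2 * Real.log (G x ^ 2))
  swap
  · rw [integral_undef hent]
    exact mul_nonneg (by positivity) (Finset.sum_nonneg fun i _ => ht i)
  have hGint : Integrable (fun x => G x ^ 2) := by
    by_contra hc
    rw [integral_undef hc] at hnorm
    exact zero_ne_one hnorm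
  set T : Fin d → ℝ := fun i => (1 / Real.pi) * (∫ x, D i x ^ 2) + 1 with hT
  have hT1 : ∀ i, 1 ≤ T i := fun i => by
    have := mul_nonneg (one_div_pos.2 hpi).le (ht i)
    simp only [hT]; linarith
  have hTpos : ∀ i, 0 < T i := fun i => by linarith [hT1 i]
  have hlogT : ∑ i, Real.log (T i) ≤ (1 / Real.pi) * ∑ i, ∫ x, D i x ^ 2 := by
    rw [Finset.mul_sum]
    refine Finset.sum_le_sum fun i _ => ?_
    have := Real.log_le_sub_one_of_pos (hTpos i)
    simp only [hT] at this ⊢; linarith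
  refine le_trans ?_ hlogT
  set F : Fin d → (Fin d → ℝ) → ℝ≥0∞ :=
    fun i x => ENNReal.ofReal ((1 / Real.pi) * D i x ^ 2 + G x ^ 2) with hFdef
  have hF : ∀ i, Measurable (F i) := fun i =>
    ((((hDm i).pow_const 2).const_mul _).add (hG.measurable.pow_const 2)).ennreal_ofReal
  have hFint : ∀ i, ∫⁻ x, F i x = ENNReal.ofReal (T i) := by
    intro i
    simp only [hFdef, hT]
    have hI : Integrable (fun x => (1 / Real.pi) * D i x ^ 2 + G x ^ 2) :=
      ((hDint i).const_mul _).add hGint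
    rw [← ofReal_integral_eq_lintegral_ofReal hI
      (Eventually.of_forall fun r => by positivity),
      integral_add ((hDint i).const_mul _) hGint, integral_const_mul, hnorm]
  have hpt : ∀ x i, ENNReal.ofReal (G x ^ 2) ≤
      lmarginal (fun _ => (volume : Measure ℝ)) {i} (F i) x := by
    intro x i
    rw [lmarginal_singleton]
    have := line_bound _ _ (hD x i) (x i)
    simpa only [Function.update_eq_self] using this
  rcases hd.eq_or_lt with h1 | h2
  · subst h1
    have hu : ({0} : Finset (Fin 1)) = Finset.univ := by simp
    have hb : ∀ x, G x ^ 2 ≤ T 0 := by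
      intro x
      have := hpt x 0
      rw [hu, lmarginal_univ, ← volume_pi, hFint] at this
      exact (ENNReal.ofReal_le_ofReal_iff (hTpos 0).le).1 this
    calc _ ≤ ∫ x, G x ^ 2 * Real.log (T 0) := by
          refine integral_mono hent (hGint.mul_const _) fun x => ?_
          rcases (sq_nonneg (G x)).eq_or_lt with h0 | h0
          · simp [← h0]
          · exact mul_le_mul_of_nonneg_left (Real.log_le_log h0 (hb x)) h0.le
      _ = _ := by rw [integral_mul_const, hnorm]; simp
  · have hd1 : (0 : ℝ) < (d : ℝ) - 1 := by
      have : (1 : ℝ) < d := by exact_mod_cast h2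
      linarith
    set p : ℝ := 1 / ((d : ℝ) - 1) with hp
    have hp0 : 0 < p := by positivity
    have hpd : ((d : ℝ) - 1) * p = 1 := by rw [hp]; field_simp
    have hpd' : (d : ℝ) * p = 1 + p := by linarith
    set P : ℝ := ∏ i, T i ^ p with hP
    have hPpos : 0 < P := Finset.prod_pos fun i _ => Real.rpow_pos_of_pos (hTpos i) _
    have hM : ∫⁻ x, ENNReal.ofReal ((G x ^ 2) ^ (1 + p)) ≤ ENNReal.ofReal P := by
      have := LW_aux F hF p hp0.le (by simpa using hpd) Finset.univ 0
      simp only [Finset.insert_eq_of_mem (Finset.mem_univ _), lmarginal_univ, ← volume_pi,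
        hFint] at this
      calc _ ≤ _ := lintegral_mono fun x => ?_
        _ ≤ _ := this
        _ = _ := by
          rw [hP, ENNReal.ofReal_prod_of_nonneg
            (fun i _ => Real.rpow_nonneg (hTpos i).le _)]
          exact Finset.prod_congr rfl fun i _ => ENNReal.ofReal_rpow_of_pos (hTpos i)
      calc ENNReal.ofReal ((G x ^ 2) ^ (1 + p))
          = ∏ i : Fin d, (ENNReal.ofReal (G x ^ 2)) ^ p := by
            rw [Finset.prod_const, Finset.card_univ, Fintype.card_fin, ← ENNReal.rpow_natCast,
              ← ENNReal.rpow_mul, mul_comm p, hpd',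
              ENNReal.ofReal_rpow_of_nonneg (sq_nonneg _) (by positivity)]
        _ ≤ _ := Finset.prod_le_prod' fun i _ => ENNReal.rpow_le_rpow (hpt x i) hp0.le
    have hmeas : Measurable fun x => (G x ^ 2) ^ (1 + p) :=
      (hG.measurable.pow_const 2).pow_const _
    have hnn : ∀ x, 0 ≤ (G x ^ 2) ^ (1 + p) := fun x => Real.rpow_nonneg (sq_nonneg _) _
    have hMi : Integrable (fun x => (G x ^ 2) ^ (1 + p)) :=
      (lintegral_ofReal_ne_top_iff_integrable hmeas.aestronglyMeasurable
        (Eventually.of_forall hnn)).1 (ne_top_of_le_ne_top ENNReal.ofReal_ne_top hM)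
    have hMr : ∫ x, (G x ^ 2) ^ (1 + p) ≤ P := by
      rw [← ofReal_integral_eq_lintegral_ofReal hMi (Eventually.of_forall hnn)] at hM
      exact (ENNReal.ofReal_le_ofReal_iff hPpos.le).1 hM
    have hlogP : Real.log P = p * ∑ i, Real.log (T i) := by
      rw [hP, Real.log_prod (fun i _ => (Real.rpow_pos_of_pos (hTpos i) _).ne'), Finset.mul_sum]
      exact Finset.sum_congr rfl fun i _ => Real.log_rpow (hTpos i) _
    have hpw : ∀ x, p * (G x ^ 2 * Real.log (G x ^ 2)) ≤
        P⁻¹ * (G x ^ 2) ^ (1 + p) + (Real.log P - 1) * G x ^ 2 := by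
      intro x
      rcases (sq_nonneg (G x)).eq_or_lt with h0 | h0
      · rw [← h0, Real.zero_rpow (by positivity)]; simp
      · have hq : 0 < (G x ^ 2) ^ p := Real.rpow_pos_of_pos h0 _
        have := Real.log_le_sub_one_of_pos (mul_pos (inv_pos.2 hPpos) hq)
        rw [Real.log_mul (inv_pos.2 hPpos).ne' hq.ne', Real.log_inv, Real.log_rpow h0] at this
        rw [Real.rpow_add h0, Real.rpow_one]
        nlinarith [mul_le_mul_of_nonneg_left this h0.le]
    have hfin := integral_mono (hent.const_mul p)
      ((hMi.const_mul P⁻¹).add (hGint.const_mul (Real.log P - 1))) hpw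
    simp only [Pi.add_apply] at hfin
    rw [integral_add (hMi.const_mul P⁻¹) (hGint.const_mul (Real.log P - 1)), integral_const_mul,
      integral_const_mul, integral_const_mul, hnorm, hlogP] at hfin
    have h3 : P⁻¹ * ∫ x, (G x ^ 2) ^ (1 + p) ≤ 1 := by
      rw [inv_mul_le_iff₀ hPpos]; simpa using hMr
    exact le_of_mul_le_mul_left (by linarith) hp0

/-- **Logarithmic Sobolev inequality for the Lebesgue measure.**
If `g : ℝ^d → ℝ` is nonnegative, differentiable, with `∫ g² = 1` and
`∫ ‖∇g‖² < ∞`, then the entropy of the probability density `f = g²` with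
respect to Lebesgue measure satisfies
`∫ g² log(g²) ≤ (1/π) ∫ ‖∇g‖²`. -/
theorem log_sobolev_lebesgue
    (d : ℕ) (hd : 1 ≤ d)
    (g : EuclideanSpace ℝ (Fin d) → ℝ)
    (hg_nonneg : ∀ x, 0 ≤ g x)
    (hg_norm : ∫ x, (g x) ^ 2 = 1)
    (hg_diff : Differentiable ℝ g)
    (hg_grad : Integrable (fun x => ‖fderiv ℝ g x‖ ^ 2)) :
    ∫ x, (g x) ^ 2 * Real.log ((g x) ^ 2)
      ≤ (1 / Real.pi) * ∫ x, ‖fderiv ℝ g x‖ ^ 2 := by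
  have hmp := PiLp.volume_preserving_toLp (Fin d)
  have hme : MeasurableEmbedding (@WithLp.toLp 2 (Fin d → ℝ)) :=
    (MeasurableEquiv.toLp 2 (Fin d → ℝ)).measurableEmbedding
  have hcont : Continuous (@WithLp.toLp 2 (Fin d → ℝ)) := PiLp.continuous_toLp 2 _
  set b := EuclideanSpace.basisFun (Fin d) ℝ with hb
  have hsum : ∀ x, ‖fderiv ℝ g x‖ ^ 2 = ∑ i, fderiv ℝ g x (b i) ^ 2 := fun x => b.norm_dual _
  have hmeas : ∀ i, Measurable (fun x => fderiv ℝ g x (b i)) :=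
    fun i => measurable_fderiv_apply_const ℝ g _
  have hint : ∀ i, Integrable (fun x => fderiv ℝ g x (b i) ^ 2) := by
    intro i
    refine hg_grad.mono' ((hmeas i).pow_const 2).aestronglyMeasurable
      (Filter.Eventually.of_forall fun x => ?_)
    rw [Real.norm_of_nonneg (sq_nonneg _), hsum]
    exact Finset.single_le_sum (f := fun i => fderiv ℝ g x (b i) ^ 2)
      (fun j _ => sq_nonneg _) (Finset.mem_univ i)
  have key := core_bound d hd (fun x => g (WithLp.toLp 2 x))
    (fun i x => fderiv ℝ g (WithLp.toLp 2 x) (b i))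
    (hg_diff.continuous.comp hcont) (fun i => (hmeas i).comp hcont.measurable) ?_
    (fun i => (hmp.integrable_comp_emb hme).2 (hint i))
    ((hmp.integral_comp hme (fun x => g x ^ 2)).trans hg_norm)
  · rw [hmp.integral_comp hme (fun x => g x ^ 2 * Real.log (g x ^ 2))] at key
    refine key.trans_eq ?_
    simp_rw [hsum]
    rw [integral_finsetSum _ fun i _ => hint i]
    congr 1
    exact Finset.sum_congr rfl fun i _ =>
      hmp.integral_comp hme (fun x => fderiv ℝ g x (b i) ^ 2)
  · intro x i s
    have h1 := hasDerivAt_update x i s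
    have h2 := (PiLp.continuousLinearEquiv 2 ℝ (fun _ : Fin d => ℝ)).symm.hasFDerivAt.comp_hasDerivAt
      s h1
    have h3 := (hg_diff (WithLp.toLp 2 (Function.update x i s))).hasFDerivAt.comp_hasDerivAt s h2
    have hbi : b i = (PiLp.continuousLinearEquiv 2 ℝ (fun _ : Fin d => ℝ)).symm
        (Pi.single i 1) := by
      rw [hb, EuclideanSpace.basisFun_apply]; rfl
    simp only [hbi]
    exact h3
end

section
/- Fix N = 3. For every integer k ≥ 1 and every m ∈ {1,…,3^k}, writing x_m = m/3^k and I_m = [x_{m−1}, x_m), the average of the digit-shift map S over I_m equals its value at the left endpoint: 3^k · ∫_{x_{m−1}}^{x_m} S(x) dx = S(x_{m−1}). -/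
/-- The `ℓ`-th digit (for `ℓ ≥ 1`) of the canonical base-`N` expansion of
`x ∈ [0,1)`: `n_ℓ = ⌊x·N^ℓ⌋ mod N`.  The resulting digit sequence is the
unique one that is not eventually equal to `N−1`. -/
noncomputable def digit (N : ℕ) (x : ℝ) (ℓ : ℕ) : ℕ :=
  (⌊x * (N : ℝ) ^ ℓ⌋).toNat % N

/-- The digit-shift map `S(x) = Σ_{ℓ≥1} ℘(n_ℓ)/N^ℓ`, where `℘` raises each
digit by one modulo `N`. -/
noncomputable def shiftMap (N : ℕ) (x : ℝ) : ℝ :=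
  ∑' ℓ : ℕ, (((digit N x (ℓ + 1) + 1) % N : ℕ) : ℝ) / (N : ℝ) ^ (ℓ + 1)

open MeasureTheory intervalIntegral

/-- The shifted digit as a real-valued function. -/
noncomputable def sdig (j : ℕ) (x : ℝ) : ℝ := (((digit 3 x j + 1) % 3 : ℕ) : ℝ)

lemma sdig_measurable (j : ℕ) : Measurable (sdig j) := by
  have h : sdig j = (fun z : ℤ => (((z.toNat % 3 + 1) % 3 : ℕ) : ℝ)) ∘
      (fun x : ℝ => ⌊x * ((3 : ℕ) : ℝ) ^ j⌋) := rfl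
  rw [h]
  exact Measurable.of_discrete.comp (Int.measurable_floor.comp (measurable_id.mul_const _))

lemma sdig_nonneg (j : ℕ) (x : ℝ) : 0 ≤ sdig j x := Nat.cast_nonneg _

lemma sdig_le (j : ℕ) (x : ℝ) : sdig j x ≤ 2 := by
  unfold sdig
  have : (digit 3 x j + 1) % 3 ≤ 2 := by omega
  exact_mod_cast this

lemma sdig_intervalIntegrable (j : ℕ) (a b : ℝ) : IntervalIntegrable (sdig j) volume a b := by
  refine (intervalIntegrable_const (c := (2 : ℝ))).mono_fun
    (sdig_measurable j).aestronglyMeasurable ?_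
  refine Filter.Eventually.of_forall fun x => ?_
  show ‖sdig j x‖ ≤ ‖(2 : ℝ)‖
  rw [Real.norm_of_nonneg (sdig_nonneg j x)]
  simpa using sdig_le j x

/-- Value on an interval of level `j + d`. -/
lemma sdig_eq (j d n : ℕ) (x : ℝ) (h1 : (n : ℝ) / 3 ^ (j + d) ≤ x)
    (h2 : x < ((n : ℝ) + 1) / 3 ^ (j + d)) :
    sdig j x = (((n / 3 ^ d % 3 + 1) % 3 : ℕ) : ℝ) := by
  have hf : ⌊x * ((3 : ℕ) : ℝ) ^ j⌋ = ((n / 3 ^ d : ℕ) : ℤ) := by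
    rw [Int.floor_eq_iff]
    rw [div_le_iff₀ (by positivity), pow_add] at h1
    rw [lt_div_iff₀ (by positivity), pow_add] at h2
    have e1 : 3 ^ d * (n / 3 ^ d) ≤ n := Nat.mul_div_le n (3 ^ d)
    have e2 : n + 1 ≤ 3 ^ d * (n / 3 ^ d + 1) := Nat.lt_mul_div_succ n (by positivity)
    have e1' : (3 : ℝ) ^ d * ((n / 3 ^ d : ℕ) : ℝ) ≤ n := by exact_mod_cast e1
    have e2' : (n : ℝ) + 1 ≤ (3 : ℝ) ^ d * (((n / 3 ^ d : ℕ) : ℝ) + 1) := by exact_mod_cast e2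
    have hp : (0 : ℝ) < 3 ^ d := by positivity
    rw [Int.cast_natCast, Nat.cast_ofNat]
    constructor
    · refine le_of_mul_le_mul_left ?_ hp
      linarith
    · refine lt_of_mul_lt_mul_left ?_ hp.le
      linarith
  unfold sdig digit
  rw [hf, Int.toNat_natCast]

/-- At a coarser left endpoint the digit is zero. -/
lemma sdig_left (k d n : ℕ) : sdig (k + (d + 1)) ((n : ℝ) / 3 ^ k) = 1 := by
  have h : (n : ℝ) / 3 ^ k = ((n * 3 ^ (d + 1) : ℕ) : ℝ) / 3 ^ (k + (d + 1) + 0) := by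
    push_cast
    rw [add_zero, pow_add 3 k]
    field_simp
  rw [sdig_eq (k + (d + 1)) 0 (n * 3 ^ (d + 1)) _ h.ge
    (by rw [h]; gcongr; linarith)]
  have : (n * 3 ^ (d + 1) / 3 ^ 0 % 3 + 1) % 3 = 1 := by
    rw [pow_succ, ← mul_assoc]; omega
  rw [this]; simp

lemma integral_fine (j d n : ℕ) :
    ∫ x in ((n : ℝ) / 3 ^ (j + d))..(((n : ℝ) + 1) / 3 ^ (j + d)), sdig j x
      = (((n / 3 ^ d % 3 + 1) % 3 : ℕ) : ℝ) / 3 ^ (j + d) := by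
  have hle : (n : ℝ) / 3 ^ (j + d) ≤ ((n : ℝ) + 1) / 3 ^ (j + d) := by gcongr; linarith
  rw [integral_of_le hle, integral_Ioc_eq_integral_Ioo,
    setIntegral_congr_fun measurableSet_Ioo
      (fun x hx => sdig_eq j d n x hx.1.le hx.2),
    ← integral_Ioc_eq_integral_Ioo, ← integral_of_le hle, intervalIntegral.integral_const]
  rw [smul_eq_mul]; ring

lemma integral_split (f : ℝ → ℝ) (hf : ∀ a b, IntervalIntegrable f volume a b) (k n : ℕ) :
    ∫ x in ((n : ℝ) / 3 ^ k)..(((n : ℝ) + 1) / 3 ^ k), f x =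
    (∫ x in (((3 * n : ℕ) : ℝ) / 3 ^ (k + 1))..((((3 * n : ℕ) : ℝ) + 1) / 3 ^ (k + 1)), f x) +
    (∫ x in (((3 * n + 1 : ℕ) : ℝ) / 3 ^ (k + 1))..((((3 * n + 1 : ℕ) : ℝ) + 1) / 3 ^ (k + 1)), f x)
    + (∫ x in (((3 * n + 2 : ℕ) : ℝ) / 3 ^ (k + 1))..((((3 * n + 2 : ℕ) : ℝ) + 1) / 3 ^ (k + 1)),
      f x) := by
  have a0 : ((3 * n : ℕ) : ℝ) / 3 ^ (k + 1) = (n : ℝ) / 3 ^ k := by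
    push_cast; rw [pow_succ]; field_simp
  have a1 : ((3 * n : ℕ) : ℝ) + 1 = ((3 * n + 1 : ℕ) : ℝ) := by push_cast; ring
  have a2 : ((3 * n + 1 : ℕ) : ℝ) + 1 = ((3 * n + 2 : ℕ) : ℝ) := by push_cast; ring
  have a3 : (((3 * n + 2 : ℕ) : ℝ) + 1) / 3 ^ (k + 1) = ((n : ℝ) + 1) / 3 ^ k := by
    push_cast; rw [pow_succ]; field_simp; ring
  rw [a0, a1, a2, a3, integral_add_adjacent_intervals (hf _ _) (hf _ _),
    integral_add_adjacent_intervals (hf _ _) (hf _ _)]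

lemma integral_coarse (d : ℕ) : ∀ k n : ℕ,
    ∫ x in ((n : ℝ) / 3 ^ k)..(((n : ℝ) + 1) / 3 ^ k), sdig (k + (d + 1)) x = 1 / 3 ^ k := by
  induction d with
  | zero =>
    intro k n
    rw [integral_split _ (sdig_intervalIntegrable _)]
    have h := fun n => integral_fine (k + 1) 0 n
    simp only [add_zero, zero_add] at h ⊢
    rw [h, h, h]
    have b0 : (3 * n / 3 ^ 0 % 3 + 1) % 3 = 1 := by omega
    have b1 : ((3 * n + 1) / 3 ^ 0 % 3 + 1) % 3 = 2 := by omega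
    have b2 : ((3 * n + 2) / 3 ^ 0 % 3 + 1) % 3 = 0 := by omega
    rw [b0, b1, b2, pow_succ]
    field_simp
    norm_num
  | succ d ih =>
    intro k n
    rw [integral_split _ (sdig_intervalIntegrable _)]
    have e : k + (d + 1 + 1) = (k + 1) + (d + 1) := by ring
    rw [e, ih, ih, ih, pow_succ]
    field_simp
    norm_num

lemma integral_sdig (j k n : ℕ) :
    ∫ x in ((n : ℝ) / 3 ^ k)..(((n : ℝ) + 1) / 3 ^ k), sdig j x
      = sdig j ((n : ℝ) / 3 ^ k) / 3 ^ k := by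
  rcases le_or_gt j k with h | h
  · obtain ⟨d, rfl⟩ := Nat.exists_eq_add_of_le h
    rw [integral_fine, sdig_eq j d n _ le_rfl (by gcongr; linarith)]
  · obtain ⟨d, rfl⟩ := Nat.exists_eq_add_of_lt h
    rw [add_assoc, integral_coarse, sdig_left]

lemma shiftMap_eq (x : ℝ) : shiftMap 3 x = ∑' l : ℕ, sdig (l + 1) x / 3 ^ (l + 1) := by
  simp [shiftMap, sdig]

lemma bound_summable : Summable fun l : ℕ => (2 : ℝ) / 3 ^ (l + 1) := by
  have h := ((summable_geometric_of_lt_one (r := (1 / 3 : ℝ)) (by norm_num) (by norm_num)).mul_left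
    (2 / 3))
  refine h.congr fun l => ?_
  rw [pow_succ, one_div, inv_pow]
  field_simp

lemma term_norm_le (l : ℕ) (x : ℝ) : ‖sdig (l + 1) x / 3 ^ (l + 1)‖ ≤ 2 / 3 ^ (l + 1) := by
  rw [Real.norm_of_nonneg (div_nonneg (sdig_nonneg _ _) (by positivity))]
  gcongr
  exact sdig_le _ _

lemma average_nat (k n : ℕ) :
    (3 : ℝ) ^ k * ∫ x in ((n : ℝ) / 3 ^ k)..(((n : ℝ) + 1) / 3 ^ k), shiftMap 3 x
      = shiftMap 3 ((n : ℝ) / 3 ^ k) := by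
  have hs : ∀ x, Summable fun l : ℕ => sdig (l + 1) x / 3 ^ (l + 1) := fun x =>
    Summable.of_norm_bounded bound_summable (fun l => term_norm_le l x)
  have h := intervalIntegral.hasSum_integral_of_dominated_convergence (μ := volume)
    (a := (n : ℝ) / 3 ^ k) (b := ((n : ℝ) + 1) / 3 ^ k)
    (F := fun (l : ℕ) x => sdig (l + 1) x / 3 ^ (l + 1)) (f := shiftMap 3)
    (fun l _ => 2 / 3 ^ (l + 1))
    (fun l => ((sdig_measurable _).div_const _).aestronglyMeasurable)
    (fun l => Filter.Eventually.of_forall fun x _ => term_norm_le l x)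
    (Filter.Eventually.of_forall fun x _ => bound_summable)
    (intervalIntegrable_const)
    (Filter.Eventually.of_forall fun x _ => by rw [shiftMap_eq]; exact (hs x).hasSum)
  have h' := h.mul_left ((3 : ℝ) ^ k)
  rw [← h'.tsum_eq, shiftMap_eq]
  refine tsum_congr fun l => ?_
  rw [intervalIntegral.integral_div, integral_sdig]
  field_simp

/-- **The average of the base-3 digit-shift map over the triadic interval
`I_m = [(m−1)/3^k, m/3^k)` equals its value at the left endpoint:**
`3^k · ∫_{(m−1)/3^k}^{m/3^k} S(x) dx = S((m−1)/3^k)`. -/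
theorem shiftMap_average (k m : ℕ) (hk : 1 ≤ k) (hm : 1 ≤ m) (hm' : m ≤ 3 ^ k) :
    (3 : ℝ) ^ k * ∫ x in ((m - 1 : ℝ) / 3 ^ k)..((m : ℝ) / 3 ^ k), shiftMap 3 x
      = shiftMap 3 ((m - 1 : ℝ) / 3 ^ k) := by
  obtain ⟨n, rfl⟩ := Nat.exists_eq_add_of_le' hm
  have h := average_nat k n
  have e : ((n + 1 : ℕ) : ℝ) - 1 = n := by push_cast; ring
  rw [e, Nat.cast_succ]
  exact h
end

section
/- Fix N = 3. For every integer k ≥ 1, every m ∈ {1,…,3^k}, and every x in the interval I_m = [(m−1)/3^k, m/3^k), the digit-shift map S satisfies |S(x) − S((m−1)/3^k)| ≤ 1/(2·3^k). -/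
theorem digit_eq_floor (x : ℝ) (l : ℕ) : digit 3 x l = ⌊x * 3 ^ l⌋₊ % 3 := by
  simp [digit, Int.floor_toNat]

theorem floor_low (x : ℝ) (k j : ℕ) (h : j ≤ k) :
    ⌊x * 3 ^ j⌋₊ = ⌊x * 3 ^ k⌋₊ / 3 ^ (k - j) := by
  rw [← Nat.floor_div_natCast]
  congr 1
  obtain ⟨d, rfl⟩ := Nat.exists_eq_add_of_le h
  rw [Nat.add_sub_cancel_left, pow_add]
  push_cast
  field_simp

theorem shift_summable (x : ℝ) :
    Summable fun l : ℕ => (((digit 3 x (l + 1) + 1) % 3 : ℕ) : ℝ) / ((3 : ℕ) : ℝ) ^ (l + 1) := by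
  refine Summable.of_nonneg_of_le (fun l => by positivity) (fun l => ?_)
    ((summable_geometric_of_lt_one (r := (1 / 3 : ℝ)) (by norm_num) (by norm_num)))
  have h : (((digit 3 x (l + 1) + 1) % 3 : ℕ) : ℝ) ≤ 3 := by
    exact_mod_cast (Nat.mod_lt _ (by norm_num)).le
  push_cast at h ⊢
  rw [pow_succ, div_pow, one_pow, div_le_div_iff₀ (by positivity) (by positivity)]
  have : (0 : ℝ) < 3 ^ l := by positivity
  nlinarith

/-- **Oscillation bound for the base-3 digit-shift map on triadic
intervals:** for `x ∈ I_m = [(m−1)/3^k, m/3^k)` one has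
`|S(x) − S((m−1)/3^k)| ≤ 1/(2·3^k)`. -/
theorem shiftMap_osc (k m : ℕ) (hk : 1 ≤ k) (hm : 1 ≤ m) (hm' : m ≤ 3 ^ k)
    (x : ℝ) (hx : x ∈ Set.Ico ((m - 1 : ℝ) / 3 ^ k) ((m : ℝ) / 3 ^ k)) :
    |shiftMap 3 x - shiftMap 3 ((m - 1 : ℝ) / 3 ^ k)| ≤ 1 / (2 * 3 ^ k) := by
  obtain ⟨n, rfl⟩ := Nat.exists_eq_add_of_le' hm
  push_cast at hx ⊢
  rw [add_sub_cancel_right] at hx ⊢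
  obtain ⟨h1, h2⟩ := hx
  have h3 : (0 : ℝ) < 3 ^ k := by positivity
  rw [div_le_iff₀ h3] at h1
  rw [lt_div_iff₀ h3] at h2
  have hfx : ⌊x * 3 ^ k⌋₊ = n :=
    (Nat.floor_eq_iff (le_trans (Nat.cast_nonneg n) h1)).2 ⟨h1, h2⟩
  have hfa : ⌊(n : ℝ) / 3 ^ k * 3 ^ k⌋₊ = n := by
    rw [div_mul_cancel₀ _ h3.ne', Nat.floor_natCast]
  have hlow : ∀ j ≤ k, digit 3 x j = digit 3 ((n : ℝ) / 3 ^ k) j := by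
    intro j hj
    rw [digit_eq_floor, digit_eq_floor, floor_low x k j hj, floor_low _ k j hj, hfx, hfa]
  have hhigh : ∀ i, digit 3 ((n : ℝ) / 3 ^ k) (i + k + 1) = 0 := by
    intro i
    rw [digit_eq_floor]
    have : (n : ℝ) / 3 ^ k * 3 ^ (i + k + 1) = ((n * 3 ^ i * 3 : ℕ) : ℝ) := by
      push_cast
      rw [pow_succ, pow_add]
      field_simp
    rw [this, Nat.floor_natCast, Nat.mul_mod_left]
  have hs := (shift_summable x).sub (shift_summable ((n : ℝ) / 3 ^ k))
  unfold shiftMap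
  rw [← (shift_summable x).tsum_sub (shift_summable ((n : ℝ) / 3 ^ k)),
    ← hs.sum_add_tsum_nat_add k, Finset.sum_eq_zero, zero_add]
  · have hg : HasSum (fun i : ℕ => (1 / 3 ^ (k + 1) : ℝ) * (1 / 3) ^ i) (1 / (2 * 3 ^ k)) := by
      have := (hasSum_geometric_of_lt_one (r := (1 / 3 : ℝ)) (by norm_num) (by norm_num)).mul_left
        (1 / 3 ^ (k + 1) : ℝ)
      have h4 : (1 / 3 ^ (k + 1) : ℝ) * (1 - 1 / 3)⁻¹ = 1 / (2 * 3 ^ k) := by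
        rw [pow_succ]
        field_simp
        norm_num
      rw [h4] at this
      exact this
    rw [← Real.norm_eq_abs]
    refine tsum_of_norm_bounded hg (fun i => ?_)
    rw [hhigh i, ← sub_div, norm_div, Real.norm_eq_abs, Real.norm_eq_abs]
    have hd : |(((digit 3 x (i + k + 1) + 1) % 3 : ℕ) : ℝ) - (((0 + 1) % 3 : ℕ) : ℝ)| ≤ 1 := by
      have : (digit 3 x (i + k + 1) + 1) % 3 < 3 := Nat.mod_lt _ (by norm_num)
      generalize (digit 3 x (i + k + 1) + 1) % 3 = d at *
      interval_cases d <;> norm_num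
    have he : (1 / 3 ^ (k + 1) : ℝ) * (1 / 3) ^ i = 1 / |((3 : ℕ) : ℝ) ^ (i + k + 1)| := by
      rw [abs_of_nonneg (by positivity), div_pow, one_pow]
      push_cast
      rw [div_mul_div_comm, one_mul]
      congr 1
      ring
    rw [he]
    gcongr
  · intro l hl
    rw [hlow (l + 1) (Finset.mem_range.1 hl), sub_self]
end

section
/- For every c > 0 and every s ∈ [−c, c], the integral of max(|s|, |t|, |s+t|) over the set of t ∈ [−c, c] with |s+t| ≤ c equals c². -/
open MeasureTheory

lemma aux_integral_max (c s : ℝ) (h0 : 0 ≤ s) (hs : s ≤ c) :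
    ∫ t in (-c)..(c - s), max |s| (max |t| |s + t|) = c ^ 2 := by
  have hcont : Continuous (fun t : ℝ => max |s| (max |t| |s + t|)) := by fun_prop
  have hi : ∀ a b : ℝ, IntervalIntegrable (fun t : ℝ => max |s| (max |t| |s + t|)) volume a b :=
    fun a b => hcont.intervalIntegrable a b
  rw [← intervalIntegral.integral_add_adjacent_intervals (hi (-c) (-s)) (hi (-s) (c - s)),
    ← intervalIntegral.integral_add_adjacent_intervals (hi (-s) 0) (hi 0 (c - s))]
  have h1 : ∫ t in (-c)..(-s), max |s| (max |t| |s + t|) = ∫ t in (-c)..(-s), -t := by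
    apply intervalIntegral.integral_congr
    intro t ht
    rw [Set.uIcc_of_le (by linarith)] at ht
    obtain ⟨_, h⟩ := ht
    simp only
    rw [abs_of_nonneg h0, abs_of_nonpos (by linarith : t ≤ 0),
      abs_of_nonpos (by linarith : s + t ≤ 0), max_eq_left (by linarith : -(s + t) ≤ -t),
      max_eq_right (by linarith)]
  have h2 : ∫ t in (-s)..0, max |s| (max |t| |s + t|) = ∫ t in (-s)..0, s := by
    apply intervalIntegral.integral_congr
    intro t ht
    rw [Set.uIcc_of_le (by linarith)] at ht
    obtain ⟨h', h⟩ := ht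
    simp only
    rw [abs_of_nonneg h0, abs_of_nonpos h, abs_of_nonneg (by linarith : 0 ≤ s + t)]
    exact max_eq_left (max_le (by linarith) (by linarith))
  have h3 : ∫ t in (0)..(c - s), max |s| (max |t| |s + t|) = ∫ t in (0)..(c - s), (s + t) := by
    apply intervalIntegral.integral_congr
    intro t ht
    rw [Set.uIcc_of_le (by linarith)] at ht
    obtain ⟨h', h⟩ := ht
    simp only
    rw [abs_of_nonneg h0, abs_of_nonneg h', abs_of_nonneg (by linarith : 0 ≤ s + t),
      max_eq_right (by linarith : t ≤ s + t), max_eq_right (by linarith)]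
  rw [h1, h2, h3, intervalIntegral.integral_neg, intervalIntegral.integral_add (by simp) (by simp)]
  simp only [integral_id, intervalIntegral.integral_const, smul_eq_mul]
  ring

/-- **Marginal computation for the non-SCE minimizer:** for `c > 0` and
`s ∈ [−c, c]`, the integral of `max(|s|, |t|, |s+t|)` over
`{t ∈ [−c,c] : |s+t| ≤ c}` equals `c²`. -/
theorem integral_max_eq_sq (c s : ℝ) (hc : 0 < c) (hs : s ∈ Set.Icc (-c) c) :
    ∫ t in {t : ℝ | -c ≤ t ∧ t ≤ c ∧ -c ≤ s + t ∧ s + t ≤ c},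
        max |s| (max |t| |s + t|) = c ^ 2 := by
  obtain ⟨ha, hb⟩ := hs
  rcases le_total 0 s with h | h
  · have hset : {t : ℝ | -c ≤ t ∧ t ≤ c ∧ -c ≤ s + t ∧ s + t ≤ c} = Set.Icc (-c) (c - s) := by
      ext t
      simp only [Set.mem_setOf_eq, Set.mem_Icc]
      constructor
      · rintro ⟨h1, h2, h3, h4⟩
        constructor <;> linarith
      · rintro ⟨h1, h2⟩
        refine ⟨?_, ?_, ?_, ?_⟩ <;> linarith
    rw [hset, integral_Icc_eq_integral_Ioc, ← intervalIntegral.integral_of_le (by linarith)]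
    exact aux_integral_max c s h hb
  · have hset : {t : ℝ | -c ≤ t ∧ t ≤ c ∧ -c ≤ s + t ∧ s + t ≤ c} = Set.Icc (-c - s) c := by
      ext t
      simp only [Set.mem_setOf_eq, Set.mem_Icc]
      constructor
      · rintro ⟨h1, h2, h3, h4⟩
        constructor <;> linarith
      · rintro ⟨h1, h2⟩
        refine ⟨?_, ?_, ?_, ?_⟩ <;> linarith
    rw [hset, integral_Icc_eq_integral_Ioc, ← intervalIntegral.integral_of_le (by linarith)]
    have key := aux_integral_max c (-s) (by linarith) (by linarith)
    have hn := intervalIntegral.integral_comp_neg (a := -c) (b := c - -s)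
      (fun t : ℝ => max |s| (max |t| |s + t|))
    rw [neg_neg, show -(c - -s) = -c - s by ring] at hn
    rw [← hn, ← key]
    congr 1
    ext t
    rw [abs_neg, abs_neg, ← abs_neg (-s + t)]
    congr 3
    ring
end

section
/- Let N ≥ 2 be an integer, let a₀ < a₁ < … < a_N be real numbers, and let μ : [a₀,a_N] → ℝ be a nonnegative integrable function with ∫_{a_{k−1}}^{a_k} μ(s) ds = 1 for each k = 1,…,N. Let f₁ = id and let f₂,…,f_N : [a₀,a_N] → [a₀,a_N] be measurable maps such that: (i) for each n, the pushforward of the measure μ(r)·1_{[a₀,a₁]}(r) dr under f_n equals the measure μ(s)·1_{[a_{n−1},a_n]}(s) ds; and (ii) for every n and every r ∈ [a₀,a₁], the N-tuple (f₁(f_n(r)),…,f_N(f_n(r))) is a permutation of (f₁(r),…,f_N(r)). Then for every bounded measurable symmetric function W : ℝ^N → ℝ, one has ∫_{a₀}^{a_N} (μ(r)/N) · W(f₁(r),…,f_N(r)) dr = ∫_{a₀}^{a₁} μ(r) · W(f₁(r),…,f_N(r)) dr. -/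
open MeasureTheory intervalIntegral

/-- **Reduction of the strictly-correlated interaction energy to the first
radial shell.**  If each co-motion function `f n` pushes the measure
`μ·1_{[a₀,a₁]} dr` forward to `μ·1_{[a_n, a_{n+1}]} ds` and the family
satisfies the group property, then for any bounded measurable symmetric
`W`, `∫_{a₀}^{a_N} (μ/N)·W(f₁,…,f_N) = ∫_{a₀}^{a₁} μ·W(f₁,…,f_N)`. -/
theorem shell_reduction
    (N : ℕ) (hN : 2 ≤ N) (a : Fin (N + 1) → ℝ) (ha : StrictMono a)
    (μ : ℝ → ℝ) (hμ_meas : Measurable μ) (hμ_nonneg : ∀ r, 0 ≤ μ r)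
    (hμ_int : IntegrableOn μ (Set.Icc (a 0) (a (Fin.last N))))
    (hμ_norm : ∀ k : Fin N, ∫ s in (a k.castSucc)..(a k.succ), μ s = 1)
    (f : Fin N → ℝ → ℝ) (hf0 : f ⟨0, by omega⟩ = id)
    (hf_meas : ∀ n, Measurable (f n))
    (hf_mapsto : ∀ n, Set.MapsTo (f n) (Set.Icc (a 0) (a (Fin.last N)))
      (Set.Icc (a 0) (a (Fin.last N))))
    (hpush : ∀ n : Fin N,
      (((volume.restrict (Set.Icc (a 0) (a 1))).withDensity
          (fun r => ENNReal.ofReal (μ r))).map (f n))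
        = (volume.restrict (Set.Icc (a n.castSucc) (a n.succ))).withDensity
            (fun s => ENNReal.ofReal (μ s)))
    (hgroup : ∀ n : Fin N, ∀ r ∈ Set.Icc (a 0) (a 1),
      ∃ σ : Equiv.Perm (Fin N), ∀ i, f i (f n r) = f (σ i) r)
    (W : (Fin N → ℝ) → ℝ) (hW_meas : Measurable W)
    (hW_bdd : ∃ C : ℝ, ∀ x, |W x| ≤ C)
    (hW_symm : ∀ (σ : Equiv.Perm (Fin N)) (x : Fin N → ℝ), W (x ∘ σ) = W x) :
    ∫ r in (a 0)..(a (Fin.last N)), (μ r / N) * W (fun i => f i r)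
      = ∫ r in (a 0)..(a 1), μ r * W (fun i => f i r) := by
  set G : ℝ → ℝ := fun r => W (fun i => f i r) with hG
  have hGm : Measurable G := hW_meas.comp (measurable_pi_lambda _ hf_meas)
  obtain ⟨C, hC⟩ := hW_bdd
  have key : ∀ s : Set ℝ, MeasurableSet s →
      ∫ r, G r ∂((volume.restrict s).withDensity (fun r => ENNReal.ofReal (μ r)))
        = ∫ r in s, μ r * G r := by
    intro s hs
    rw [integral_withDensity_eq_integral_toReal_smul hμ_meas.ennreal_ofReal
      (Filter.Eventually.of_forall fun _ => ENNReal.ofReal_lt_top)]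
    refine integral_congr_ae (Filter.Eventually.of_forall fun r => ?_)
    simp [ENNReal.toReal_ofReal (hμ_nonneg r)]
  have hGf : ∀ n : Fin N, ∀ r ∈ Set.Icc (a 0) (a 1), G (f n r) = G r := by
    intro n r hr
    obtain ⟨σ, hσ⟩ := hgroup n r hr
    have h1 := hW_symm σ (fun i => f i r)
    simp only [hG, hσ]
    exact h1
  have shell : ∀ n : Fin N, ∫ r in (a n.castSucc)..(a n.succ), μ r * G r
      = ∫ r in (a 0)..(a 1), μ r * G r := by
    intro n
    have h01 : a 0 ≤ a 1 := ha.monotone (Fin.zero_le _)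
    have hn : a n.castSucc ≤ a n.succ := ha.monotone (Fin.castSucc_lt_succ).le
    rw [integral_of_le h01, integral_of_le hn, ← integral_Icc_eq_integral_Ioc,
      ← integral_Icc_eq_integral_Ioc, ← key _ measurableSet_Icc, ← key _ measurableSet_Icc,
      ← hpush n, integral_map (hf_meas n).aemeasurable hGm.aestronglyMeasurable]
    refine integral_congr_ae ?_
    refine (withDensity_absolutelyContinuous _ _).ae_le ?_
    filter_upwards [ae_restrict_mem measurableSet_Icc] with r hr
    exact hGf n r hr
  have hint : IntegrableOn (fun r => μ r * G r) (Set.Icc (a 0) (a (Fin.last N))) := by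
    refine Integrable.mul_bdd (c := C) hμ_int hGm.aestronglyMeasurable ?_
    exact Filter.Eventually.of_forall fun r => hC _
  have hsum : ∫ r in (a 0)..(a (Fin.last N)), μ r * G r
      = ∑ n : Fin N, ∫ r in (a n.castSucc)..(a n.succ), μ r * G r := by
    let b : ℕ → ℝ := fun k => if h : k < N + 1 then a ⟨k, h⟩ else 0
    have hb : ∀ k (h : k < N + 1), b k = a ⟨k, h⟩ := fun k h => dif_pos h
    have h := sum_integral_adjacent_intervals (f := fun r => μ r * G r) (μ := volume)
      (a := b) (n := N) (by
        intro k hk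
        rw [hb k (by omega), hb (k + 1) (by omega),
          intervalIntegrable_iff_integrableOn_Icc_of_le (ha.monotone (by simp))]
        exact hint.mono_set (Set.Icc_subset_Icc (ha.monotone (Fin.zero_le _))
          (ha.monotone (Fin.le_last _))))
    rw [hb 0 (by omega), hb N (by omega)] at h
    rw [Finset.sum_range] at h
    refine Eq.trans h.symm (Finset.sum_congr rfl fun n _ => ?_)
    rw [hb n (by omega), hb (n + 1) (by omega)]
    rfl
  have hN0 : (N : ℝ) ≠ 0 := by
    have : N ≠ 0 := by omega
    exact_mod_cast this
  have h2 : ∀ r, μ r / N * G r = (N : ℝ)⁻¹ * (μ r * G r) := fun r => by ring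
  change ∫ r in (a 0)..(a (Fin.last N)), (μ r / N) * G r = ∫ r in (a 0)..(a 1), μ r * G r
  simp only [h2]
  rw [intervalIntegral.integral_const_mul, hsum, Finset.sum_congr rfl (fun n _ => shell n)]
  simp [hN0]
end

section
/- Let N ≥ 1 be an integer, I ⊆ ℝ an interval, V : ℝ^N → ℝ differentiable, U : ℝ → ℝ differentiable, and f₁,…,f_N : I → ℝ differentiable functions such that for every r ∈ I and every i ∈ {1,…,N}, U′(f_i(r)) = (∂V/∂r_i)(f₁(r),…,f_N(r)). Then the function r ↦ V(f₁(r),…,f_N(r)) − Σ_{i=1}^{N} U(f_i(r)) is constant on I. -/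
/-- **The total potential energy is constant along the strictly-correlated
manifold:** if `U′(f_i(r)) = ∂V/∂r_i (f₁(r),…,f_N(r))` for all `r` in an
interval `I` and all `i`, then `r ↦ V(f₁(r),…,f_N(r)) − Σᵢ U(fᵢ(r))` is
constant on `I`. -/
theorem comotion_energy_constant
    (N : ℕ) (hN : 1 ≤ N) (I : Set ℝ) (hI : I.OrdConnected)
    (V : (Fin N → ℝ) → ℝ) (hV : Differentiable ℝ V)
    (U : ℝ → ℝ) (hU : Differentiable ℝ U)
    (f : Fin N → ℝ → ℝ) (hf : ∀ i, DifferentiableOn ℝ (f i) I)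
    (hUV : ∀ r ∈ I, ∀ i : Fin N,
      deriv U (f i r) = fderiv ℝ V (fun j => f j r) (Pi.single i 1)) :
    ∀ r ∈ I, ∀ r' ∈ I,
      V (fun j => f j r) - ∑ i : Fin N, U (f i r)
        = V (fun j => f j r') - ∑ i : Fin N, U (f i r') := by
  intro r hr r' hr'
  have key : ∀ x ∈ I, HasDerivWithinAt
      (fun x => V (fun j => f j x) - ∑ i : Fin N, U (f i x)) 0 I x := by
    intro x hx
    have h1 : ∀ i, HasDerivWithinAt (f i) (derivWithin (f i) I x) I x :=
      fun i => (hf i x hx).hasDerivWithinAt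
    have h2 : HasDerivWithinAt (fun x j => f j x) (fun j => derivWithin (f j) I x) I x :=
      hasDerivWithinAt_pi.2 h1
    have h3 := (hV (fun j => f j x)).hasFDerivAt.comp_hasDerivWithinAt x h2
    have h4 : HasDerivWithinAt (fun x => ∑ i : Fin N, U (f i x))
        (∑ i : Fin N, deriv U (f i x) * derivWithin (f i) I x) I x :=
      HasDerivWithinAt.fun_sum fun i _ =>
        (hU (f i x)).hasDerivAt.comp_hasDerivWithinAt x (h1 i)
    have h5 := h3.sub h4
    refine h5.congr_deriv ?_
    rw [sub_eq_zero]
    conv_lhs => rw [pi_eq_sum_univ' (fun j => derivWithin (f j) I x)]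
    rw [map_sum]
    refine Finset.sum_congr rfl fun i _ => ?_
    rw [map_smul, hUV x hx i, smul_eq_mul, mul_comm]
  have h := hI.convex.norm_image_sub_le_of_norm_hasDerivWithin_le (C := 0) key
    (fun x _ => by simp) hr' hr
  rw [zero_mul] at h
  exact sub_eq_zero.1 (norm_le_zero_iff.1 h)
end

section
/- Let N ≥ 1 be an integer, K ⊆ ℝ a compact interval, and let V : ℝ^N → ℝ be twice continuously differentiable on a neighborhood of K^N and U : ℝ → ℝ twice continuously differentiable on a neighborhood of K. Let ε₀ > 0, C ≥ 0, and for each ε ∈ [0,ε₀) let F^ε = (F^ε₁,…,F^ε_N) : [0,1] → K^N be measurable with sup_{ν∈[0,1]} |F^ε_n(ν) − F^0_n(ν)| ≤ Cε for all n. Assume that for all ν ∈ [0,1] and all n, U′(F^0_n(ν)) = (∂V/∂r_n)(F^0₁(ν),…,F^0_N(ν)). Then there exists a constant C′ ≥ 0 such that for all ε ∈ [0,ε₀), | ∫₀¹ [V(F^ε(ν)) − V(F^0(ν))] dν − Σ_{n=1}^{N} ∫₀¹ [U(F^ε_n(ν)) − U(F^0_n(ν))] dν | ≤ C′ ε². 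-/
open MeasureTheory intervalIntegral

theorem taylor_aux {E : Type*} [NormedAddCommGroup E] [NormedSpace ℝ E]
    (G : E → ℝ) (O K : Set E) (hO : IsOpen O) (hKO : K ⊆ O) (hK : IsCompact K)
    (hc : Convex ℝ K) (hG : ContDiffOn ℝ 2 G O) :
    ∃ M : ℝ, 0 ≤ M ∧ ∀ x ∈ K, ∀ y ∈ K,
      |G y - G x - fderiv ℝ G x (y - x)| ≤ M * ‖y - x‖ ^ 2 := by
  have h1 : ContDiffOn ℝ 1 (fderiv ℝ G) O := hG.fderiv_of_isOpen hO (by norm_num)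
  have h2 : ContinuousOn (fderiv ℝ (fderiv ℝ G)) O :=
    h1.continuousOn_fderiv_of_isOpen hO (by norm_num)
  obtain ⟨M, hM⟩ := hK.exists_bound_of_continuousOn (E := E →L[ℝ] E →L[ℝ] ℝ)
    (f := fderiv ℝ (fderiv ℝ G)) (h2.mono hKO)
  refine ⟨max M 0, le_max_right _ _, fun x hx y hy => ?_⟩
  have hseg : segment ℝ x y ⊆ K := hc.segment_subset hx hy
  have hd1 : ∀ z ∈ K, DifferentiableAt ℝ (fderiv ℝ G) z := fun z hz =>
    (h1.contDiffAt (hO.mem_nhds (hKO hz))).differentiableAt (by norm_num)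
  have hd0 : ∀ z ∈ K, DifferentiableAt ℝ G z := fun z hz =>
    (hG.contDiffAt (hO.mem_nhds (hKO hz))).differentiableAt (by norm_num)
  have key := (convex_segment x y).norm_image_sub_le_of_norm_hasFDerivWithin_le'
    (f := G) (f' := fderiv ℝ G) (φ := fderiv ℝ G x) (C := max M 0 * ‖y - x‖)
    (fun z hz => (hd0 z (hseg hz)).hasFDerivAt.hasFDerivWithinAt)
    (fun z hz => by
      have := hc.norm_image_sub_le_of_norm_fderiv_le (𝕜 := ℝ) (f := fderiv ℝ G)
        (C := max M 0) hd1 (fun w hw => (hM w hw).trans (le_max_left _ _)) hx (hseg hz)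
      refine this.trans (mul_le_mul_of_nonneg_left ?_ (le_max_right _ _))
      obtain ⟨t, ht, rfl⟩ := (segment_eq_image' ℝ x y) ▸ hz
      simp only [add_sub_cancel_left, norm_smul, Real.norm_eq_abs, abs_of_nonneg ht.1]
      exact mul_le_of_le_one_left (norm_nonneg _) ht.2)
    (left_mem_segment ℝ x y) (right_mem_segment ℝ x y)
  rw [Real.norm_eq_abs] at key
  linarith [key, sq ‖y - x‖, mul_assoc (max M 0) ‖y - x‖ ‖y - x‖,
    congrArg (fun t => max M 0 * t) (sq ‖y - x‖)]

theorem integrable_aux {E : Type*} [NormedAddCommGroup E] [MeasurableSpace E] [BorelSpace E]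
    (G : E → ℝ) (K : Set E) (hK : IsCompact K) (hG : ContinuousOn G K)
    (g : ℝ → E) (hg : Measurable g) (hgK : ∀ ν ∈ Set.Icc (0:ℝ) 1, g ν ∈ K) :
    IntervalIntegrable (fun ν => G (g ν)) volume 0 1 := by
  classical
  rw [intervalIntegrable_iff_integrableOn_Icc_of_le zero_le_one]
  obtain ⟨M, hM⟩ := hK.exists_bound_of_continuousOn hG
  have hm : Measurable (K.piecewise G (fun _ => (0:ℝ))) :=
    hG.measurable_piecewise continuousOn_const hK.isClosed.measurableSet
  refine Integrable.of_bound (C := M) ?_ ?_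
  · refine ((hm.comp hg).aestronglyMeasurable (μ := volume.restrict (Set.Icc (0:ℝ) 1))).congr ?_
    refine (ae_restrict_iff' measurableSet_Icc).2 (Filter.Eventually.of_forall fun ν hν => ?_)
    simp [Set.piecewise, hgK ν hν]
  · exact (ae_restrict_iff' measurableSet_Icc).2
      (Filter.Eventually.of_forall fun ν hν => hM _ (hgK ν hν))

/-- **Second-order estimate underlying the functional derivative of the SGS
functional.**  If the reparametrized co-motion functions `F^ε` of the
perturbed density stay within `Cε` of `F^0`, take values in the compact
interval `K = [A,B]`, `V` and `U` are `C²` on open neighborhoods of `K^N`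
and `K`, and `U′(F⁰_n(ν)) = ∂V/∂r_n(F⁰(ν))`, then the difference of the
energy integrals matches the difference of the potential integrals up to
`O(ε²)`, uniformly for `ε ∈ [0, ε₀)`. -/
theorem sgs_functional_derivative_estimate
    (N : ℕ) (hN : 1 ≤ N) (A B : ℝ) (hAB : A ≤ B)
    (O : Set (Fin N → ℝ)) (hO : IsOpen O)
    (hKO : (Set.univ.pi fun _ : Fin N => Set.Icc A B) ⊆ O)
    (V : (Fin N → ℝ) → ℝ) (hV : ContDiffOn ℝ 2 V O)
    (O' : Set ℝ) (hO' : IsOpen O') (hKO' : Set.Icc A B ⊆ O')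
    (U : ℝ → ℝ) (hU : ContDiffOn ℝ 2 U O')
    (ε₀ : ℝ) (hε₀ : 0 < ε₀) (C : ℝ) (hC : 0 ≤ C)
    (F : ℝ → Fin N → ℝ → ℝ)
    (hF_meas : ∀ ε n, Measurable (F ε n))
    (hF_mem : ∀ ε ∈ Set.Ico 0 ε₀, ∀ n : Fin N, ∀ ν ∈ Set.Icc (0:ℝ) 1,
      F ε n ν ∈ Set.Icc A B)
    (hF_close : ∀ ε ∈ Set.Ico 0 ε₀, ∀ n : Fin N, ∀ ν ∈ Set.Icc (0:ℝ) 1,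
      |F ε n ν - F 0 n ν| ≤ C * ε)
    (hUV : ∀ ν ∈ Set.Icc (0:ℝ) 1, ∀ n : Fin N,
      deriv U (F 0 n ν) = fderiv ℝ V (fun j => F 0 j ν) (Pi.single n 1)) :
    ∃ C' : ℝ, 0 ≤ C' ∧ ∀ ε ∈ Set.Ico 0 ε₀,
      |(∫ ν in (0:ℝ)..1, (V (fun n => F ε n ν) - V (fun n => F 0 n ν)))
        - ∑ n : Fin N, ∫ ν in (0:ℝ)..1, (U (F ε n ν) - U (F 0 n ν))|
      ≤ C' * ε ^ 2 := by
  have hKc : IsCompact (Set.univ.pi fun _ : Fin N => Set.Icc A B) :=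
    isCompact_univ_pi fun _ => isCompact_Icc
  obtain ⟨M, hM0, hM⟩ := taylor_aux V O _ hO hKO hKc (convex_pi fun _ _ => convex_Icc A B) hV
  obtain ⟨L, hL0, hL⟩ := taylor_aux U O' _ hO' hKO' isCompact_Icc (convex_Icc A B) hU
  refine ⟨(M + N * L) * C ^ 2, by positivity, fun ε hε => ?_⟩
  have h0 : (0:ℝ) ∈ Set.Ico 0 ε₀ := ⟨le_rfl, hε₀⟩
  have iV : ∀ e ∈ Set.Ico 0 ε₀,
      IntervalIntegrable (fun ν => V (fun n => F e n ν)) volume 0 1 := fun e he =>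
    integrable_aux V _ hKc (hV.continuousOn.mono hKO) (fun ν n => F e n ν)
      (measurable_pi_lambda _ fun n => hF_meas e n) (fun ν hν n _ => hF_mem e he n ν hν)
  have iU : ∀ e ∈ Set.Ico 0 ε₀, ∀ n,
      IntervalIntegrable (fun ν => U (F e n ν)) volume 0 1 := fun e he n =>
    integrable_aux U _ isCompact_Icc (hU.continuousOn.mono hKO') (F e n)
      (hF_meas e n) (fun ν hν => hF_mem e he n ν hν)
  rw [← intervalIntegral.integral_finsetSum (fun n _ => (iU ε hε n).sub (iU 0 h0 n)),
    ← intervalIntegral.integral_sub ((iV ε hε).sub (iV 0 h0))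
      (by
        have := IntervalIntegrable.sum (μ := volume) (a := 0) (b := 1) Finset.univ
          (f := fun n ν => U (F ε n ν) - U (F 0 n ν))
          (fun n _ => (iU ε hε n).sub (iU 0 h0 n))
        have e : (fun ν => ∑ n : Fin N, (U (F ε n ν) - U (F 0 n ν)))
            = ∑ n : Fin N, fun ν => U (F ε n ν) - U (F 0 n ν) := by
          funext ν
          simp
        first
          | exact this
          | (rw [e]; exact this))]
  have hCε : 0 ≤ C * ε := mul_nonneg hC hε.1
  have key := intervalIntegral.norm_integral_le_of_norm_le_const (a := (0:ℝ)) (b := 1)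
    (f := fun ν => (V (fun n => F ε n ν) - V (fun n => F 0 n ν))
      - ∑ n : Fin N, (U (F ε n ν) - U (F 0 n ν))) (C := (M + N * L) * C ^ 2 * ε ^ 2) ?_
  · simpa using key
  intro ν hν'
  rw [Set.uIoc_of_le zero_le_one] at hν'
  have hν : ν ∈ Set.Icc (0:ℝ) 1 := Set.Ioc_subset_Icc_self hν'
  have a1 := hM (fun n => F 0 n ν) (fun n _ => hF_mem 0 h0 n ν hν)
    (fun n => F ε n ν) (fun n _ => hF_mem ε hε n ν hν)
  have a2 : ∀ n, |U (F ε n ν) - U (F 0 n ν) - deriv U (F 0 n ν) * (F ε n ν - F 0 n ν)|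
      ≤ L * (C * ε) ^ 2 := fun n => by
    have := hL _ (hF_mem 0 h0 n ν hν) _ (hF_mem ε hε n ν hν)
    rw [fderiv_eq_smul_deriv, smul_eq_mul, mul_comm] at this
    rw [mul_comm (deriv U _)] 
    rw [mul_comm] at this
    refine (by simpa [mul_comm] using this : _ ≤ L * |F ε n ν - F 0 n ν| ^ 2).trans ?_
    gcongr
    exact hF_close ε hε n ν hν
  have a3 : ‖(fun n => F ε n ν) - (fun n => F 0 n ν)‖ ≤ C * ε :=
    (pi_norm_le_iff_of_nonneg hCε).2 fun n => by
      simpa using hF_close ε hε n ν hν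
  have a4 : fderiv ℝ V (fun n => F 0 n ν) ((fun n => F ε n ν) - (fun n => F 0 n ν))
      = ∑ n, deriv U (F 0 n ν) * (F ε n ν - F 0 n ν) := by
    conv_lhs => rw [pi_eq_sum_univ' ((fun n => F ε n ν) - (fun n => F 0 n ν))]
    rw [map_sum]
    refine Finset.sum_congr rfl fun n _ => ?_
    rw [map_smul, hUV ν hν n, smul_eq_mul, mul_comm]
    rfl
  have a5 : |∑ n, (U (F ε n ν) - U (F 0 n ν) - deriv U (F 0 n ν) * (F ε n ν - F 0 n ν))|
      ≤ N * (L * (C * ε) ^ 2) := by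
    refine (Finset.abs_sum_le_sum_abs _ _).trans ?_
    refine (Finset.sum_le_sum fun n _ => a2 n).trans ?_
    simp
  rw [Finset.sum_sub_distrib, ← a4] at a5
  have a6 := a1.trans (mul_le_mul_of_nonneg_left (pow_le_pow_left₀ (norm_nonneg _) a3 2) hM0)
  rw [Real.norm_eq_abs]
  rw [abs_le] at a5 a6 ⊢
  constructor <;> nlinarith [a5.1, a5.2, a6.1, a6.2]
end
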